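/- The program It = box[X,x₁,x₂,x₃] in declare It(Y,x,y,z){var u; u := y; while(z ≠ ε){u := Y(lmin(u,x)↾x); z := pred(z)} return u} in call It(X,x₁,x₂,x₃) belongs to SAFE₀ ∩ SCP_S, is terminating, and computes the padded variant of the bounded iterator I': for every total f : W → W and all words a, b, c ∈ W, ⟦It⟧(f)(a,b,c) = G^{|c|}(b) where G(x) = f(⟦↾⟧(lmin(x,a), a)). -/

import Mathlib

set_option maxHeartbeats 1000000

/-! ## Words -/

/-- Words over the alphabet `Σ = {0,1}` (`false` = `0`, `true` = `1`). -/
abbrev Wd := List Bool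

/-- `v ⊴ w` : `v` is a subword of `w`. -/
def Subword (v w : Wd) : Prop := ∃ u u' : Wd, w = u ++ v ++ u'

/-- `v ↾ n` : truncation of `v` to its first `min n |v|` symbols, then padding with a
word of the form `1·0^k` so that the result has length exactly `n+1`. -/
def truncN (v : Wd) (n : ℕ) : Wd :=
  v.take n ++ [true] ++ List.replicate (n - (v.take n).length) false

/-- The semantics `⟦↾⟧(v,w) = v ↾ |w|` of the truncation-padding operator. -/
def truncW (v w : Wd) : Wd := truncN v w.length

/-- `lmin(a,b)` : the length-minimum of two words. -/
def lminW (a b : Wd) : Wd := if a.length < b.length then a else b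

/-- Kapron-Steinberg's bounded iterator `I'`. -/
def Iprime (F : Wd → Wd) (a b c : Wd) : Wd := (fun x => F (lminW x a))^[c.length] b

/-- Encoding of a tuple of words as a single word. -/
def encTuple (ws : List Wd) : Wd :=
  (ws.map (fun w => (w.flatMap fun b => [true, b]) ++ [false, false])).flatten

/-! ## Simple types over `W` and functionals -/

/-- Simple types over the base type `W` of words. -/
inductive Ty where
  | W : Ty
  | arrow : Ty → Ty → Ty
deriving DecidableEq, Repr

/-- Set-theoretic interpretation of a simple type. -/
def Ty.interp : Ty → Type
  | .W => Wd
  | .arrow a b => a.interp → b.interp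

/-- The order of a simple type. -/
def Ty.order : Ty → ℕ
  | .W => 0
  | .arrow a b => max (a.order + 1) b.order

/-- A functional of simple type over `W`. -/
def Functional : Type := Σ T : Ty, T.interp

/-- The type `W → ⋯ → W` (`l` arguments). -/
def ty1 : ℕ → Ty
  | 0 => .W
  | l + 1 => .arrow .W (ty1 l)

/-- The type `(W→W) → ⋯ → (W→W) → W → ⋯ → W` (`k` order-1 arguments, `l` order-0 ones). -/
def ty2 : ℕ → ℕ → Ty
  | 0, l => ty1 l
  | k + 1, l => .arrow (.arrow .W .W) (ty2 k l)

def curry1 : (l : ℕ) → ((Fin l → Wd) → Wd) → (ty1 l).interp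
  | 0, F => F (fun i => i.elim0)
  | l + 1, F => fun w => curry1 l (fun ws => F (Fin.cons w ws))

def curry2 : (k l : ℕ) → ((Fin k → (Wd → Wd)) → (Fin l → Wd) → Wd) → (ty2 k l).interp
  | 0, l, F => curry1 l (F (fun i => i.elim0))
  | k + 1, l, F => fun f => curry2 k l (fun fs => F (Fin.cons f fs))

def curryList : (n : ℕ) → (List Wd → Wd) → (ty1 n).interp :=
  fun n g => curry1 n (fun ws => g (List.ofFn ws))

/-- Types of second-order functionals, in the normalized shape `(W→W)^k → W^l → W`. -/
def IsTy2 (T : Ty) : Prop := ∃ k l, T = ty2 k l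

/-- Restriction of a set of functionals to the second-order ones. -/
def restrict2 (S : Set Functional) : Set Functional := { F ∈ S | IsTy2 F.1 }

/-! ## Simply-typed lambda closure -/

/-- Simply-typed lambda terms (de Bruijn style) with constants from a set `S` of
functionals of simple type over `W`. -/
inductive STLC (S : Set Functional) : List Ty → Ty → Type where
  | const {Γ : List Ty} (F : Functional) (h : F ∈ S) : STLC S Γ F.1
  | var {Γ : List Ty} (i : Fin Γ.length) : STLC S Γ (Γ.get i)
  | abs {Γ : List Ty} {T T' : Ty} : STLC S (T :: Γ) T' → STLC S Γ (.arrow T T')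
  | app {Γ : List Ty} {T T' : Ty} : STLC S Γ (.arrow T T') → STLC S Γ T → STLC S Γ T'

/-- Interpretation of typing contexts. -/
def EnvI : List Ty → Type
  | [] => PUnit
  | T :: Γ => T.interp × EnvI Γ

def lookupE : {Γ : List Ty} → (i : Fin Γ.length) → EnvI Γ → (Γ.get i).interp
  | _ :: _, ⟨0, _⟩, ρ => ρ.1
  | _ :: Γ, ⟨i + 1, h⟩, ρ => lookupE (Γ := Γ) ⟨i, Nat.lt_of_succ_lt_succ h⟩ ρ.2

/-- Denotational semantics of simply-typed lambda terms. -/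
def STLC.denote {S : Set Functional} : {Γ : List Ty} → {T : Ty} → STLC S Γ T → EnvI Γ → T.interp
  | _, _, .const F _, _ => F.2
  | _, _, .var i, ρ => lookupE i ρ
  | _, _, .abs t, ρ => fun v => t.denote (v, ρ)
  | _, _, .app t s, ρ => (t.denote ρ) (s.denote ρ)

/-- `λ(S)` : the set of functionals denoted by closed simply-typed lambda terms with
constants from `S`. -/
def lambdaClosure (S : Set Functional) : Set Functional :=
  fun G => ∃ t : STLC S [] G.1, t.denote PUnit.unit = G.2

/-- `λ(S)₂` : the second-order simply-typed lambda closure of `S`. -/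
def lambdaClosure2 (S : Set Functional) : Set Functional := restrict2 (lambdaClosure S)
/-! ## Operators

A fixed suite of operators, indexed by natural numbers:
`0 = ε`, `1 = pred`, `2 = suc₀`, `3 = suc₁`, `4 = head`, `5 = ==`, `6 = !=`, `7 = lmin`;
every other index denotes the (neutral) constant-`ε` operator. -/

def opArity : ℕ → ℕ
  | 0 => 0
  | 1 => 1 | 2 => 1 | 3 => 1 | 4 => 1
  | 5 => 2 | 6 => 2 | 7 => 2
  | _ => 0

def opSem : ℕ → List Wd → Wd
  | 0, _ => []
  | 1, ws => (ws.getD 0 []).tail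
  | 2, ws => false :: ws.getD 0 []
  | 3, ws => true :: ws.getD 0 []
  | 4, ws => (ws.getD 0 []).take 1
  | 5, ws => [decide (ws.getD 0 [] = ws.getD 1 [])]
  | 6, ws => [decide (ws.getD 0 [] ≠ ws.getD 1 [])]
  | 7, ws => lminW (ws.getD 0 []) (ws.getD 1 [])
  | _, _ => []

/-- A neutral operator: constant (of arity 0), a `{0,1}`-valued predicate, or an operator
whose output is always a subword of one of its inputs. -/
def NeutralOp (o : ℕ) : Prop :=
  opArity o = 0 ∨ (∀ ws, opSem o ws = [false] ∨ opSem o ws = [true]) ∨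
    (∀ ws : List Wd, ws.length = opArity o → ∃ w ∈ ws, Subword (opSem o ws) w)

/-- A positive operator: the output length exceeds the maximal input length by at most a
constant. -/
def PositiveOp (o : ℕ) : Prop :=
  ∃ c : ℕ, ∀ ws : List Wd, (opSem o ws).length ≤ (ws.map List.length).foldr max 0 + c

/-! ## Syntax of the programming language -/

/-- Variables: type-0 variables `v0 x`, type-1 variables `v1 X`, higher-order variables
`vh a`. -/
inductive Var where
  | v0 : ℕ → Var
  | v1 : ℕ → Var
  | vh : ℕ → Var
deriving DecidableEq

/-- Expressions. `oracleCall X e₁ e₂` is the oracle call `X(e₁ ↾ e₂)`. -/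
inductive Expr where
  | var : ℕ → Expr
  | op : ℕ → List Expr → Expr
  | oracleCall : ℕ → Expr → Expr → Expr

/-- Statements. -/
inductive Stmt where
  | skip : Stmt
  | assign : ℕ → Expr → Stmt
  | seq : Stmt → Stmt → Stmt
  | ite : Expr → Stmt → Stmt → Stmt
  | while : Expr → Stmt → Stmt

/-- Procedures `P(X̄, x̄){var ȳ; st return z}`. -/
structure Proc where
  name : ℕ
  oparams : List ℕ
  params : List ℕ
  locals : List ℕ
  body : Stmt
  ret : ℕ

/-- Terms.  A closure `{x → t}` is represented as the pair `(x, t)`. -/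
inductive Tm where
  | var : Var → Tm
  | lam : Var → Tm → Tm
  | app : Tm → Tm → Tm
  | call : ℕ → List (ℕ × Tm) → List Tm → Tm

/-- Programs. -/
inductive Prog where
  | term : Tm → Prog
  | declare : List Proc → Prog → Prog
  | box : Var → Prog → Prog

def mkBoxes (as : List Var) (p : Prog) : Prog := as.foldr .box p

/-- The list of procedures declared in a program. -/
def procsOf : Prog → List Proc
  | .term _ => []
  | .declare ps p => ps ++ procsOf p
  | .box _ p => procsOf p

/-- Substitution `t[s/a]` on terms. -/
def Tm.subst (a : Var) (s : Tm) : Tm → Tm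
  | .var b => if b = a then s else .var b
  | .lam b t => if b = a then .lam b t else .lam b (Tm.subst a s t)
  | .app t1 t2 => .app (Tm.subst a s t1) (Tm.subst a s t2)
  | .call P cs ts =>
      .call P
        (cs.attach.map fun c => (c.1.1, if Var.v0 c.1.1 = a then c.1.2 else Tm.subst a s c.1.2))
        (ts.attach.map fun t => Tm.subst a s t.1)
decreasing_by all_goals
  first
  | (simp only [Tm.lam.sizeOf_spec, Tm.app.sizeOf_spec]; omega)
  | (have h := List.sizeOf_lt_of_mem c.2
     rcases c with ⟨⟨cx, ct⟩, hc⟩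
     simp only [Tm.call.sizeOf_spec, Prod.mk.sizeOf_spec] at *
     omega)
  | (have h := List.sizeOf_lt_of_mem t.2
     simp only [Tm.call.sizeOf_spec]; omega)

/-! ## Program sizes -/

def Expr.size : Expr → ℕ
  | .var _ => 1
  | .op _ args => 1 + (args.attach.map (fun e => e.1.size)).sum
  | .oracleCall _ e1 e2 => 2 + e1.size + e2.size
decreasing_by all_goals
  first
  | (simp only [Expr.oracleCall.sizeOf_spec]; omega)
  | (have h := List.sizeOf_lt_of_mem e.2
     simp only [Expr.op.sizeOf_spec]; omega)

def Stmt.size : Stmt → ℕ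
  | .skip => 1
  | .assign _ e => 2 + e.size
  | .seq s1 s2 => 1 + s1.size + s2.size
  | .ite e s1 s2 => 1 + e.size + s1.size + s2.size
  | .while e s => 1 + e.size + s.size

def Tm.size : Tm → ℕ
  | .var _ => 1
  | .lam _ t => 2 + t.size
  | .app t1 t2 => 1 + t1.size + t2.size
  | .call _ cs ts =>
      2 + (cs.attach.map (fun c => 2 + c.1.2.size)).sum + (ts.attach.map (fun t => t.1.size)).sum
decreasing_by all_goals
  first
  | (simp only [Tm.lam.sizeOf_spec, Tm.app.sizeOf_spec]; omega)
  | (have h := List.sizeOf_lt_of_mem c.2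
     rcases c with ⟨⟨cx, ct⟩, hc⟩
     simp only [Tm.call.sizeOf_spec, Prod.mk.sizeOf_spec] at *
     omega)
  | (have h := List.sizeOf_lt_of_mem t.2
     simp only [Tm.call.sizeOf_spec]; omega)

def Proc.size (p : Proc) : ℕ :=
  2 + p.oparams.length + p.params.length + p.locals.length + p.body.size

/-- The size `|prg|` of a program: the total number of symbols in `prg`. -/
def Prog.size : Prog → ℕ
  | .term t => t.size
  | .declare ps p => 1 + (ps.map Proc.size).sum + p.size
  | .box _ p => 2 + p.size

/-! ## Encoding of programs as words -/

def encNat (n : ℕ) : Wd := List.replicate n true ++ [false]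

def Expr.enc : Expr → Wd
  | .var x => [false, false] ++ encNat x
  | .op o args => [false, true] ++ encNat o ++ encNat args.length
      ++ (args.attach.map (fun e => e.1.enc)).flatten
  | .oracleCall X e1 e2 => [true, false] ++ encNat X ++ e1.enc ++ e2.enc
decreasing_by all_goals
  first
  | (simp only [Expr.oracleCall.sizeOf_spec]; omega)
  | (have h := List.sizeOf_lt_of_mem e.2
     simp only [Expr.op.sizeOf_spec]; omega)

def Stmt.enc : Stmt → Wd
  | .skip => [false, false, false]
  | .assign x e => [false, false, true] ++ encNat x ++ e.enc
  | .seq s1 s2 => [false, true, false] ++ s1.enc ++ s2.enc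
  | .ite e s1 s2 => [false, true, true] ++ e.enc ++ s1.enc ++ s2.enc
  | .while e s => [true, false, false] ++ e.enc ++ s.enc

def Proc.enc (p : Proc) : Wd :=
  encNat p.name ++ encNat p.oparams.length ++ (p.oparams.map encNat).flatten
    ++ encNat p.params.length ++ (p.params.map encNat).flatten
    ++ encNat p.locals.length ++ (p.locals.map encNat).flatten
    ++ p.body.enc ++ encNat p.ret

def Var.enc : Var → Wd
  | .v0 x => [false] ++ encNat x
  | .v1 X => [true, false] ++ encNat X
  | .vh a => [true, true] ++ encNat a

def Tm.enc : Tm → Wd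
  | .var a => [false, false] ++ a.enc
  | .lam a t => [false, true] ++ a.enc ++ t.enc
  | .app t1 t2 => [true, false] ++ t1.enc ++ t2.enc
  | .call P cs ts => [true, true] ++ encNat P ++ encNat cs.length
      ++ (cs.attach.map (fun c => encNat c.1.1 ++ c.1.2.enc)).flatten
      ++ encNat ts.length ++ (ts.attach.map (fun t => t.1.enc)).flatten
decreasing_by all_goals
  first
  | (simp only [Tm.lam.sizeOf_spec, Tm.app.sizeOf_spec]; omega)
  | (have h := List.sizeOf_lt_of_mem c.2
     rcases c with ⟨⟨cx, ct⟩, hc⟩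
     simp only [Tm.call.sizeOf_spec, Prod.mk.sizeOf_spec] at *
     omega)
  | (have h := List.sizeOf_lt_of_mem t.2
     simp only [Tm.call.sizeOf_spec]; omega)

/-- A standard binary encoding of programs. -/
def Prog.enc : Prog → Wd
  | .term t => [false] ++ t.enc
  | .declare ps p => [true, false] ++ encNat ps.length ++ (ps.map Proc.enc).flatten ++ p.enc
  | .box a p => [true, true] ++ a.enc ++ p.enc
/-! ## Operational semantics -/

/-- A store: a pair of finite partial maps assigning words to type-0 variables and
total functions on words to type-1 variables. -/
structure Store where
  w : ℕ → Option Wd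
  o : ℕ → Option (Wd → Wd)

def Store.updW0 (μ : Store) (x : ℕ) (v : Wd) : Store :=
  ⟨fun y => if y = x then some v else μ.w y, μ.o⟩

def Store.updWs (μ : Store) (xs : List ℕ) (vs : List Wd) : Store :=
  (xs.zip vs).foldl (fun m p => m.updW0 p.1 p.2) μ

/-- `a ∈ dom(μ)`. -/
def StoreDefined (μ : Store) : Var → Prop
  | .v0 x => (μ.w x).isSome
  | .v1 X => (μ.o X).isSome
  | .vh _ => False

/-- Continuations: maps from type-1 variables to closures. -/
def Cnt : Type := ℕ → Option (ℕ × Tm)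

/-- The continuation `X̄ ↦ c̄`. -/
def contOf (Xs : List ℕ) (cs : List (ℕ × Tm)) : Cnt :=
  fun X => ((Xs.zip cs).find? (fun q => q.1 == X)).map (·.2)

/-- Values of the call-by-name reduction on terms. -/
inductive IsVal : Tm → Prop
  | var0 (x : ℕ) : IsVal (.var (.v0 x))
  | lam (a : Var) (t : Tm) : IsVal (.lam a t)
  | oapp (X : ℕ) (t : Tm) : IsVal (.app (.var (.v1 X)) t)
  | call (P : ℕ) (cs : List (ℕ × Tm)) (ts : List Tm) : IsVal (.call P cs ts)

/-- Big-step call-by-name reduction `t ↓ v` on terms. -/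
inductive BigStep : Tm → Tm → Prop
  | val {t : Tm} : IsVal t → BigStep t t
  | app {t1 t2 t v : Tm} {a : Var} :
      BigStep t1 (.lam a t) → BigStep (Tm.subst a t2 t) v → BigStep (.app t1 t2) v

mutual
/-- `(σ, μ, φ, e) →exp w`. -/
inductive EvalExpr : List Proc → Store → Cnt → Expr → Wd → Prop
  | var {σ μ φ x v} : μ.w x = some v → EvalExpr σ μ φ (.var x) v
  | op {σ μ φ o args} (ws : List Wd) :
      args.length = opArity o → ws.length = args.length →
      (∀ (i : ℕ) (e : Expr) (w : Wd), args[i]? = some e → ws[i]? = some w → EvalExpr σ μ φ e w) →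
      EvalExpr σ μ φ (.op o args) (opSem o ws)
  | orc {σ μ φ X e1 e2 v u x t w} :
      EvalExpr σ μ φ e1 v → EvalExpr σ μ φ e2 u → φ X = some (x, t) →
      EvalTm σ (μ.updW0 x (truncW v u)) t w →
      EvalExpr σ μ φ (.oracleCall X e1 e2) w

/-- `(σ, μ, φ, st) →st μ'`. -/
inductive EvalStmt : List Proc → Store → Cnt → Stmt → Store → Prop
  | skip {σ μ φ} : EvalStmt σ μ φ .skip μ
  | asg {σ μ φ x e w} : EvalExpr σ μ φ e w → EvalStmt σ μ φ (.assign x e) (μ.updW0 x w)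
  | seq {σ μ φ s1 s2 μ' μ''} :
      EvalStmt σ μ φ s1 μ' → EvalStmt σ μ' φ s2 μ'' → EvalStmt σ μ φ (.seq s1 s2) μ''
  | condT {σ μ φ e s1 s0 μ'} :
      EvalExpr σ μ φ e [true] → EvalStmt σ μ φ s1 μ' → EvalStmt σ μ φ (.ite e s1 s0) μ'
  | condF {σ μ φ e s1 s0 μ'} :
      EvalExpr σ μ φ e [false] → EvalStmt σ μ φ s0 μ' → EvalStmt σ μ φ (.ite e s1 s0) μ'
  | whF {σ μ φ e s} : EvalExpr σ μ φ e [false] → EvalStmt σ μ φ (.while e s) μ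
  | whT {σ μ φ e s μ'} :
      EvalExpr σ μ φ e [true] → EvalStmt σ μ φ (.seq s (.while e s)) μ' →
      EvalStmt σ μ φ (.while e s) μ'

/-- `(σ, μ, t) →env w` for type-0 terms. -/
inductive EvalTm : List Proc → Store → Tm → Wd → Prop
  | tvar {σ μ t x v} : BigStep t (.var (.v0 x)) → μ.w x = some v → EvalTm σ μ t v
  | oa {σ μ t X t1 w f} :
      BigStep t (.app (.var (.v1 X)) t1) → EvalTm σ μ t1 w → μ.o X = some f →
      EvalTm σ μ t (f w)
  | call {σ μ t P cs ts p μ' v} (ws : List Wd) :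
      BigStep t (.call P cs ts) → p ∈ σ → p.name = P →
      cs.length = p.oparams.length → ts.length = p.params.length →
      ws.length = ts.length →
      (∀ (i : ℕ) (t1 : Tm) (w : Wd), ts[i]? = some t1 → ws[i]? = some w → EvalTm σ μ t1 w) →
      EvalStmt σ ((μ.updWs p.params ws).updWs p.locals (List.replicate p.locals.length []))
        (contOf p.oparams cs) p.body μ' →
      μ'.w p.ret = some v →
      EvalTm σ μ t v
end

/-- `(σ, μ, prg) →env w` for programs. -/
inductive EvalProg : List Proc → Store → Prog → Wd → Prop
  | term {σ μ t v} : EvalTm σ μ t v → EvalProg σ μ (.term t) v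
  | dec {σ μ ps prg v} : EvalProg (σ ++ ps) μ prg v → EvalProg σ μ (.declare ps prg) v
  | box {σ μ a prg v} : StoreDefined μ a → EvalProg σ μ prg v → EvalProg σ μ (.box a prg) v

/-- The initial store mapping the boxed variables `X̄` and `x̄` to the inputs. -/
def initStore (Xs xs : List ℕ) (fl : List (Wd → Wd)) (wl : List Wd) : Store :=
  ⟨fun x => (xs.findIdx? (fun y => y == x)).bind (fun i => wl[i]?),
   fun X => (Xs.findIdx? (fun y => y == X)).bind (fun i => fl[i]?)⟩

/-- A closed program in normal form: `box[X̄, x̄] in declare p̄ in t`. -/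
def IsNF (prg : Prog) : Prop :=
  ∃ (Xs xs : List ℕ) (ps : List Proc) (t : Tm), Xs.Nodup ∧ xs.Nodup ∧
    prg = mkBoxes (Xs.map Var.v1 ++ xs.map Var.v0) (.declare ps (.term t))

/-- `prg` is a closed program in normal form computing the total second-order functional
`F : (W→W)^k → W^l → W`. -/
def computesTotal (prg : Prog) (k l : ℕ)
    (F : (Fin k → (Wd → Wd)) → (Fin l → Wd) → Wd) : Prop :=
  ∃ (Xs xs : List ℕ) (ps : List Proc) (t : Tm),
    Xs.length = k ∧ xs.length = l ∧ Xs.Nodup ∧ xs.Nodup ∧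
    prg = mkBoxes (Xs.map Var.v1 ++ xs.map Var.v0) (.declare ps (.term t)) ∧
    ∀ (fs : Fin k → (Wd → Wd)) (ws : Fin l → Wd),
      EvalProg [] (initStore Xs xs (List.ofFn fs) (List.ofFn ws)) prg (F fs ws)

/-- `SN` : the set of terminating programs, i.e. those whose computed second-order
functional is total. -/
def SN : Set Prog := { prg | ∃ k l F, computesTotal prg k l F }

/-- `⟦S⟧` : the set of (total second-order) functionals computed by the programs of `S`. -/
def progFunSet (S : Set Prog) : Set Functional :=
  { G | ∃ prg ∈ S, ∃ k l F, computesTotal prg k l F ∧ G = ⟨ty2 k l, curry2 k l F⟩ }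
/-! ## The tier-based type system -/

/-- Variable typing environments: tiers for type-0 variables. -/
def VEnv : Type := ℕ → Option ℕ

/-- Operator typing environments: `Δ op k_in` is a set of first-order tiers
`k₁ → ⋯ → kₙ → k'`, represented as pairs `(list of argument tiers, result tier)`. -/
def OTE : Type := ℕ → ℕ → Set (List ℕ × ℕ)

/-- Tier-based typing judgments `Γ, Δ ⊢ e : (k, k_in, k_out)` for expressions. -/
inductive TyExpr (Γ : VEnv) (Δ : OTE) : Expr → ℕ × ℕ × ℕ → Prop
  | evar {x k kin kout} : Γ x = some k → TyExpr Γ Δ (.var x) (k, kin, kout)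
  | eop {o args ks k kin kout} :
      (ks, k) ∈ Δ o kin → ks.length = args.length →
      (∀ (i : ℕ) (κ : ℕ) (e : Expr), ks[i]? = some κ → args[i]? = some e →
        TyExpr Γ Δ e (κ, kin, kout)) →
      TyExpr Γ Δ (.op o args) (k, kin, kout)
  | eor {X e1 e2 k kin kout} :
      TyExpr Γ Δ e1 (k, kin, kout) → TyExpr Γ Δ e2 (kout, kin, kout) →
      k < kin → k ≤ kout →
      TyExpr Γ Δ (.oracleCall X e1 e2) (k, kin, kout)

/-- Tier-based typing judgments `Γ, Δ ⊢ st : (k, k_in, k_out)` for statements. -/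
inductive TyStmt (Γ : VEnv) (Δ : OTE) : Stmt → ℕ × ℕ × ℕ → Prop
  | ssk {kin kout} : TyStmt Γ Δ .skip (0, kin, kout)
  | ssub {st k kin kout} : TyStmt Γ Δ st (k, kin, kout) → TyStmt Γ Δ st (k + 1, kin, kout)
  | sseq {s1 s2 k kin kout} :
      TyStmt Γ Δ s1 (k, kin, kout) → TyStmt Γ Δ s2 (k, kin, kout) →
      TyStmt Γ Δ (.seq s1 s2) (k, kin, kout)
  | sasg {x e k1 k2 kin kout} :
      Γ x = some k1 → TyExpr Γ Δ e (k2, kin, kout) → k1 ≤ k2 →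
      TyStmt Γ Δ (.assign x e) (k1, kin, kout)
  | scnd {e s1 s0 k kin kout} :
      TyExpr Γ Δ e (k, kin, kout) → TyStmt Γ Δ s1 (k, kin, kout) →
      TyStmt Γ Δ s0 (k, kin, kout) →
      TyStmt Γ Δ (.ite e s1 s0) (k, kin, kout)
  | swinit {e st k kin} :
      TyExpr Γ Δ e (k, kin, k) → TyStmt Γ Δ st (k, k, k) → 1 ≤ k →
      TyStmt Γ Δ (.while e st) (k, kin, 0)
  | swh {e st k kin kout} :
      TyExpr Γ Δ e (k, kin, kout) → TyStmt Γ Δ st (k, k, kout) → 1 ≤ k → k ≤ kout →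
      TyStmt Γ Δ (.while e st) (k, kin, kout)

/-- Simple typing environments. -/
def TEnv : Type := Var → Option Ty

def TEnv.upd (Γ : TEnv) (a : Var) (T : Ty) : TEnv :=
  fun b => if b = a then some T else Γ b

/-- Procedure typing environments: each procedure is assigned a variable typing
environment and a triplet of tiers. -/
def PEnv : Type := Proc → VEnv × (ℕ × ℕ × ℕ)

/-- Simple typing judgments for terms, with rank bound `R` on the simple types of
lambda-abstractions.  `procs` is the list of procedures in scope. -/
inductive TyTm (R : WithTop ℕ) (Δ : OTE) (procs : List Proc) : TEnv → Tm → Ty → Prop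
  | pvar {ΓW a T} : ΓW a = some T → TyTm R Δ procs ΓW (.var a) T
  | pabs {ΓW a t T T'} :
      TyTm R Δ procs (ΓW.upd a T) t T' → ((Ty.arrow T T').order : WithTop ℕ) ≤ R →
      TyTm R Δ procs ΓW (.lam a t) (.arrow T T')
  | papp {ΓW t1 t2 T T'} :
      TyTm R Δ procs ΓW t1 (.arrow T T') → TyTm R Δ procs ΓW t2 T →
      TyTm R Δ procs ΓW (.app t1 t2) T'
  | pcall {ΓW P cs ts p} :
      p ∈ procs → p.name = P →
      cs.length = p.oparams.length → ts.length = p.params.length →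
      (∀ c ∈ cs, TyTm R Δ procs (ΓW.upd (.v0 c.1) .W) c.2 .W) →
      (∀ t ∈ ts, TyTm R Δ procs ΓW t .W) →
      TyTm R Δ procs ΓW (.call P cs ts) .W

/-- Simple typing judgments for programs. -/
inductive TyProg (R : WithTop ℕ) (Δ : OTE) (Ω : PEnv) : List Proc → TEnv → Prog → Ty → Prop
  | pterm {procs ΓW t T} : TyTm R Δ procs ΓW t T → TyProg R Δ Ω procs ΓW (.term t) T
  | pdec {procs ΓW ps prg T} :
      (∀ p ∈ ps, TyStmt (Ω p).1 Δ p.body (Ω p).2) →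
      TyProg R Δ Ω (procs ++ ps) ΓW prg T →
      TyProg R Δ Ω procs ΓW (.declare ps prg) T
  | pbox {procs ΓW a prg T T'} :
      TyProg R Δ Ω procs (ΓW.upd a T) prg T' →
      TyProg R Δ Ω procs ΓW (.box a prg) (.arrow T T')

/-! ## FP : polynomial time computable functions (via (oracle) Turing machines) -/

/-- Second-order polynomials with `k` function variables and `l` base variables. -/
inductive SOP (k l : ℕ) where
  | const : ℕ → SOP k l
  | var : Fin l → SOP k l
  | app : Fin k → SOP k l → SOP k l
  | add : SOP k l → SOP k l → SOP k l
  | mul : SOP k l → SOP k l → SOP k l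

def SOP.eval {k l : ℕ} : SOP k l → (Fin k → ℕ → ℕ) → (Fin l → ℕ) → ℕ
  | .const n, _, _ => n
  | .var j, _, xs => xs j
  | .app i p, fs, xs => fs i (p.eval fs xs)
  | .add p q, fs, xs => p.eval fs xs + q.eval fs xs
  | .mul p q, fs, xs => p.eval fs xs * q.eval fs xs

/-- The size `|f|` of an oracle `f` : `|f|(n) = max_{|y| ≤ n} |f(y)|`. -/
noncomputable def oSize (f : Wd → Wd) (n : ℕ) : ℕ :=
  sSup { s | ∃ y : Wd, y.length ≤ n ∧ s = (f y).length }

inductive TDir where | left | right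

/-- A Turing machine tape over the alphabet `Option Bool` (`none` = blank), with finitely
many non-blank cells. -/
structure MTape where
  left : List (Option Bool)
  head : Option Bool
  right : List (Option Bool)

def MTape.move : TDir → MTape → MTape
  | .left, ⟨[], h, r⟩ => ⟨[], none, h :: r⟩
  | .left, ⟨a :: l, h, r⟩ => ⟨l, a, h :: r⟩
  | .right, ⟨l, h, []⟩ => ⟨h :: l, none, []⟩
  | .right, ⟨l, h, a :: r⟩ => ⟨h :: l, a, r⟩

def MTape.write (b : Option Bool) (t : MTape) : MTape := ⟨t.left, b, t.right⟩

/-- The word written on the tape from the head rightwards, up to the first blank. -/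
def MTape.wordAt (t : MTape) : Wd :=
  ((t.head :: t.right).takeWhile Option.isSome).filterMap id

/-- Replace the tape content, from the head rightwards, by the word `w`. -/
def MTape.setWord (w : Wd) (t : MTape) : MTape :=
  ⟨t.left, w.head?, w.tail.map some⟩

def MTape.init (w : Wd) : MTape := ⟨[], w.head?, w.tail.map some⟩

inductive OTMAct (k n : ℕ) where
  | halt
  | step (write : Option Bool) (mv : TDir) (next : Fin n)
  | query (i : Fin k) (next : Fin n)

/-- A deterministic oracle Turing machine with `k` oracles; a `query i` step replaces the
tape content at the head by the answer of the `i`-th oracle on it. -/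
structure OTM (k : ℕ) where
  n : ℕ
  δ : Fin (n + 1) → Option Bool → OTMAct k (n + 1)

def OTM.step1 {k : ℕ} (M : OTM k) (fs : Fin k → Wd → Wd)
    (c : Fin (M.n + 1) × MTape) : Fin (M.n + 1) × MTape :=
  match M.δ c.1 c.2.head with
  | .halt => c
  | .step b d q' => (q', (c.2.write b).move d)
  | .query i q' => (q', c.2.setWord (fs i c.2.wordAt))

def OTM.isHalt {k : ℕ} (M : OTM k) (c : Fin (M.n + 1) × MTape) : Prop :=
  M.δ c.1 c.2.head = .halt

/-- `M` on oracles `fs` and input `inp` halts within `T` steps with output `out`. -/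
def OTM.Outputs {k : ℕ} (M : OTM k) (fs : Fin k → Wd → Wd) (inp out : Wd) (T : ℕ) : Prop :=
  ∃ m ≤ T, M.isHalt ((M.step1 fs)^[m] (0, MTape.init inp)) ∧
    ((M.step1 fs)^[m] (0, MTape.init inp)).2.wordAt = out

/-- The empty family of oracles. -/
def noOracle : Fin 0 → Wd → Wd := fun i => i.elim0

/-- The empty family of oracle sizes. -/
def noOSize : Fin 0 → ℕ → ℕ := fun i => i.elim0

/-- `g` (of arity `n`) is polynomial-time computable. -/
def InFP (n : ℕ) (g : List Wd → Wd) : Prop :=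
  ∃ (M : OTM 0) (P : SOP 0 n), ∀ ws : List Wd, ws.length = n →
    M.Outputs noOracle (encTuple ws) (g ws)
      (P.eval noOSize (fun j => (ws.getD j []).length))

/-- The class `FP` of first-order polynomial time computable functions, as a set of
functionals of simple type over `W`. -/
def FPset : Set Functional :=
  { G | ∃ n g, InFP n g ∧ G = ⟨ty1 n, curryList n g⟩ }

/-! ## Safe operator typing environments and safe programs -/

/-- A safe operator typing environment. -/
def SafeOTE (Δ : OTE) : Prop :=
  ∀ o k ks k', (ks, k') ∈ Δ o k →
    (NeutralOp o ∨ PositiveOp o) ∧ InFP (opArity o) (opSem o) ∧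
    ks.length = opArity o ∧
    (∀ ki ∈ ks, k' ≤ ki ∧ ki ≤ k) ∧
    (¬ NeutralOp o → k' < k)

/-- Programs typable (with a second-order type) under the given safe operator typing
environment, with rank bound `R`. -/
def SAFEdet (R : WithTop ℕ) (Δ : OTE) : Set Prog :=
  { prg | ∃ (ΓW : TEnv) (Ω : PEnv) (T : Ty), TyProg R Δ Ω [] ΓW prg T ∧ IsTy2 T }

/-- `SAFE` : the set of safe programs. -/
def SAFE : Set Prog := { prg | ∃ Δ : OTE, SafeOTE Δ ∧ prg ∈ SAFEdet ⊤ Δ }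

/-- `SAFE_r` : the set of safe rank-`r` programs. -/
def SAFEr (r : ℕ) : Set Prog := { prg | ∃ Δ : OTE, SafeOTE Δ ∧ prg ∈ SAFEdet (r : WithTop ℕ) Δ }

/-! ## Safe and terminating procedures -/

/-- The canonical procedure-call term `call P({z → Y₁@z}, …, {z → Y_k@z}, ȳ)` with the
boxed variables `Y_i = v1 i` and `y_j = v0 j`. -/
def ProcCallTm (p : Proc) : Tm :=
  .call p.name
    ((List.range p.oparams.length).map fun i =>
      (p.params.length, Tm.app (.var (.v1 i)) (.var (.v0 p.params.length))))
    ((List.range p.params.length).map fun j => Tm.var (.v0 j))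

def procInitStore (p : Proc) (fl : List (Wd → Wd)) (wl : List Wd) : Store :=
  initStore (List.range p.oparams.length) (List.range p.params.length) fl wl

/-- A terminating procedure. -/
def ProcTerminates (p : Proc) : Prop :=
  ∀ (fl : List (Wd → Wd)) (wl : List Wd),
    fl.length = p.oparams.length → wl.length = p.params.length →
    ∃ v, EvalTm [p] (procInitStore p fl wl) (ProcCallTm p) v

/-- A safe procedure: its body is tier-typable under some safe operator typing
environment. -/
def ProcSafe (p : Proc) : Prop :=
  ∃ (Γ : VEnv) (Δ : OTE) (ks : ℕ × ℕ × ℕ), SafeOTE Δ ∧ TyStmt Γ Δ p.body ks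

/-- The procedure `p` computes the total second-order functional `F`. -/
def ProcComputes (p : Proc) (k l : ℕ)
    (F : (Fin k → (Wd → Wd)) → (Fin l → Wd) → Wd) : Prop :=
  p.oparams.length = k ∧ p.params.length = l ∧
  ∀ (fs : Fin k → (Wd → Wd)) (ws : Fin l → Wd),
    EvalTm [p] (procInitStore p (List.ofFn fs) (List.ofFn ws)) (ProcCallTm p) (F fs ws)

/-- `⟦ST⟧` : the functionals computed by safe and terminating procedures. -/
def STfuns : Set Functional :=
  { G | ∃ p k l F, ProcSafe p ∧ ProcComputes p k l F ∧ G = ⟨ty2 k l, curry2 k l F⟩ }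

/-- The wrapper program `box[Ȳ, ȳ] in declare p in call P({z → Y₁@z}, …, ȳ)`. -/
def wrapperOf (p : Proc) : Prog :=
  mkBoxes ((List.range p.oparams.length).map .v1 ++ (List.range p.params.length).map .v0)
    (.declare [p] (.term (ProcCallTm p)))

/-! ## BFF -/

/-- `BFF` : the basic feasible functionals, i.e. the second-order functionals computable
by an oracle Turing machine in time bounded by a second-order polynomial in the sizes of
the oracles and the lengths of the inputs. -/
def BFF : Set Functional :=
  { G | ∃ (k l : ℕ) (M : OTM k) (P : SOP k l)
          (F : (Fin k → (Wd → Wd)) → (Fin l → Wd) → Wd),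
      (∀ fs xs, M.Outputs fs (encTuple (List.ofFn xs)) (F fs xs)
        (P.eval (fun i => oSize (fs i)) (fun j => (xs j).length))) ∧
      G = ⟨ty2 k l, curry2 k l F⟩ }

/-! ## Polynomial-time decision problems -/

/-- A polynomial-time decidable language of words. -/
def PTimeLang (L : Set Wd) : Prop :=
  ∃ (M : OTM 0) (P : SOP 0 1), ∀ w : Wd,
    (w ∈ L → M.Outputs noOracle w [true] (P.eval noOSize (fun _ => w.length))) ∧
    (w ∉ L → M.Outputs noOracle w [false] (P.eval noOSize (fun _ => w.length)))

/-- A polynomial-time computable function on words. -/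
def PTimeFun (r : Wd → Wd) : Prop :=
  ∃ (M : OTM 0) (P : SOP 0 1), ∀ w : Wd,
    M.Outputs noOracle w (r w) (P.eval noOSize (fun _ => w.length))

/-- A `P`-complete language: in `P`, and every language in `P` reduces to it via a
polynomial-time many-one reduction. -/
def PComplete (L : Set Wd) : Prop :=
  PTimeLang L ∧ ∀ L' : Set Wd, PTimeLang L' →
    ∃ r : Wd → Wd, PTimeFun r ∧ ∀ w, w ∈ L' ↔ r w ∈ L

/-- The language of (encodings of) the programs in `S`. -/
def encLang (S : Set Prog) : Set Wd := { w | ∃ prg ∈ S, w = prg.enc }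

/-- The set `S` of programs is decidable in time `T` (as a function of the program
size). -/
def DecidesInTime (S : Set Prog) (T : ℕ → ℕ) : Prop :=
  ∃ M : OTM 0, ∀ prg : Prog,
    (prg ∈ S → M.Outputs noOracle prg.enc [true] (T prg.size)) ∧
    (prg ∉ S → M.Outputs noOracle prg.enc [false] (T prg.size))
/-! ## Size-change graphs and the criterion `SCP_S` -/

/-- A size-change graph over the type-0 variables: `G y z = some true` is a down-arrow
from `y` to `z`, `some false` a plain arrow, `none` no arrow. -/
def SCG : Type := ℕ → ℕ → Option Bool

instance : Inhabited SCG := ⟨fun _ _ => none⟩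

/-- `op` is decreasing in its `i`-th argument (`strict = true` for strictly
decreasing): fixed choices for the concrete operator suite
(`pred` strictly decreasing in 0, `head` decreasing in 0, `lmin` decreasing in 1). -/
def opDec : ℕ → Option (ℕ × Bool)
  | 1 => some (0, true)
  | 4 => some (0, false)
  | 7 => some (1, false)
  | _ => none

/-- The size-change graph of an assignment `x := e` with (optional) in-arrow to `x`
from `src.1`, a down-arrow when `src.2 = true`; all other variables keep identity
arrows, and `x` receives no other in-arrow. -/
def mkSCG (x : ℕ) (src : Option (ℕ × Bool)) : SCG := fun y z =>
  if z = x then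
    match src with
    | some s => if y = s.1 then some s.2 else none
    | none => none
  else if y = z then some false
  else none

/-- The (source, strictness) of the arrow pointing into the assigned variable, as
determined by the right-hand side expression. -/
def exprSrc : Expr → Option (ℕ × Bool)
  | .var y => some (y, false)
  | .op o args =>
      match opDec o with
      | some (i, d) =>
          match args[i]? with
          | some (.var xi) => some (xi, d)
          | _ => none
      | none => none
  | .oracleCall _ _ _ => none

/-- Finite iteration (Kleene star) of a set of finite sequences of size-change graphs. -/
inductive StarMem (X : Set (List SCG)) : List SCG → Prop
  | nil : StarMem X []
  | cons {a b : List SCG} : a ∈ X → StarMem X b → StarMem X (a ++ b)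

/-- Append a finite sequence in front of an infinite one. -/
def appendInf (a : List SCG) (s : ℕ → SCG) : ℕ → SCG :=
  fun n => if n < a.length then a.getD n default else s (n - a.length)

def flatNthAux : ℕ → (ℕ → List SCG) → ℕ → ℕ → SCG
  | 0, g, i, n => (g i).getD n default
  | fuel + 1, g, i, n =>
      if n < (g i).length then (g i).getD n default
      else flatNthAux fuel g (i + 1) (n - (g i).length)

/-- The infinite concatenation of infinitely many nonempty finite sequences. -/
def flatten (g : ℕ → List SCG) : ℕ → SCG := fun n => flatNthAux (n + 1) g 0 n

/-- `L(st)` : the language of finite (first component) and infinite (second component)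
sequences of size-change graphs associated with a statement. -/
def Ls : Stmt → Set (List SCG) × Set (ℕ → SCG)
  | .skip => ({[]}, ∅)
  | .assign x e => ({[mkSCG x (exprSrc e)]}, ∅)
  | .seq s1 s2 =>
      ({ l | ∃ a ∈ (Ls s1).1, ∃ b ∈ (Ls s2).1, l = a ++ b },
       (Ls s1).2 ∪ { f | ∃ a ∈ (Ls s1).1, ∃ g ∈ (Ls s2).2, f = appendInf a g })
  | .ite _ s1 s2 => ((Ls s1).1 ∪ (Ls s2).1, (Ls s1).2 ∪ (Ls s2).2)
  | .while _ s =>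
      (StarMem (Ls s).1,
       { f | ∃ a, StarMem (Ls s).1 a ∧ ∃ g ∈ (Ls s).2, f = appendInf a g } ∪
       { f | ∃ g : ℕ → List SCG, (∀ n, g n ∈ (Ls s).1 ∧ g n ≠ []) ∧ f = flatten g })

/-- Fan-in freeness of a finite sequence of size-change graphs: each node has in-degree
at most one. -/
def FanInFreeL (gs : List SCG) : Prop :=
  ∀ G ∈ gs, ∀ z y1 y2, (G y1 z).isSome → (G y2 z).isSome → y1 = y2

/-- Fan-in freeness of an infinite sequence of size-change graphs. -/
def FanInFreeI (f : ℕ → SCG) : Prop :=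
  ∀ n z y1 y2, (f n y1 z).isSome → (f n y2 z).isSome → y1 = y2

/-- A down-thread from `x` to `x` in a finite sequence of size-change graphs: a path
spanning every graph of the sequence, starting and ending in `x`, and containing a
down-arrow. -/
def FinDT (x : ℕ) (gs : List SCG) : Prop :=
  ∃ p : ℕ → ℕ, p 0 = x ∧ p gs.length = x ∧
    (∀ i < gs.length, ((gs.getD i default) (p i) (p (i + 1))).isSome) ∧
    (∃ i < gs.length, (gs.getD i default) (p i) (p (i + 1)) = some true)

/-- A down-thread from `x` in an infinite sequence of size-change graphs. -/
def InfDT (x : ℕ) (f : ℕ → SCG) : Prop :=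
  ∃ p : ℕ → ℕ, p 0 = x ∧ (∀ i, (f i (p i) (p (i + 1))).isSome) ∧
    (∃ i, f i (p i) (p (i + 1)) = some true)

open scoped Classical in
/-- Restriction of a size-change graph to a set `V` of variables. -/
noncomputable def SCG.res (V : Set ℕ) (G : SCG) : SCG :=
  fun y z => if y ∈ V ∧ z ∈ V then G y z else none

noncomputable def resList (V : Set ℕ) (gs : List SCG) : List SCG := gs.map (SCG.res V)

noncomputable def resInf (V : Set ℕ) (f : ℕ → SCG) : ℕ → SCG := fun n => (f n).res V

/-- Recognize a while guard of the shape `x ≠ ε`. -/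
def isNeqEps : Expr → Option ℕ
  | .op 6 [.var x, .op 0 []] => some x
  | _ => none

/-- The set of variables occurring in while guards (of the shape `x ≠ ε`). -/
def guardVars : Stmt → Set ℕ
  | .skip => ∅
  | .assign _ _ => ∅
  | .seq s1 s2 => guardVars s1 ∪ guardVars s2
  | .ite _ s1 s2 => guardVars s1 ∪ guardVars s2
  | .while e s =>
      (match isNeqEps e with | some x => {x} | none => ∅) ∪ guardVars s

/-- The simple graph property for the set `V` of variables: every while loop has a guard
of the shape `x ≠ ε` and every (finite or infinite) sequence of size-change graphs of its
body, restricted to `V`, is fan-in free and contains a down-thread from `x` to `x`. -/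
def SGP (V : Set ℕ) : Stmt → Prop
  | .skip => True
  | .assign _ _ => True
  | .seq s1 s2 => SGP V s1 ∧ SGP V s2
  | .ite _ s1 s2 => SGP V s1 ∧ SGP V s2
  | .while e s =>
      (∃ x, isNeqEps e = some x ∧
        (∀ gs ∈ (Ls s).1, FanInFreeL (resList V gs) ∧ FinDT x (resList V gs)) ∧
        (∀ f ∈ (Ls s).2, FanInFreeI (resInf V f) ∧ InfDT x (resInf V f))) ∧
      SGP V s

/-- A procedure satisfying the simple-graph size-change criterion. -/
def ProcSCP (p : Proc) : Prop := SGP (guardVars p.body) p.body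

/-- `SCP_S` : programs all of whose procedures satisfy the simple-graph size-change
criterion. -/
def SCPs : Set Prog := { prg | ∀ p ∈ procsOf prg, ProcSCP p }
/-- The procedure
`It(Y,x,y,z){var u; u := y; while(z ≠ ε){u := Y(lmin(u,x)↾x); z := pred(z)} return u}`
(with `Y = 0`, `x = 1`, `y = 2`, `z = 3`, `u = 4`). -/
def itProc : Proc :=
  { name := 0, oparams := [0], params := [1, 2, 3], locals := [4],
    body :=
      .seq (.assign 4 (.var 2))
        (.while (.op 6 [.var 3, .op 0 []])
          (.seq (.assign 4 (.oracleCall 0 (.op 7 [.var 4, .var 1]) (.var 1)))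
                (.assign 3 (.op 1 [.var 3])))),
    ret := 4 }

/-- The program `It = box[X,x₁,x₂,x₃] in declare It(Y,x,y,z){…} in call It(X,x₁,x₂,x₃)`
(with `X = v1 1`, `x₁ = v0 5`, `x₂ = v0 6`, `x₃ = v0 7`, closure variable `v0 8`). -/
def itProg : Prog :=
  mkBoxes [.v1 1, .v0 5, .v0 6, .v0 7]
    (.declare [itProc]
      (.term (.call 0 [(8, .app (.var (.v1 1)) (.var (.v0 8)))]
        [.var (.v0 5), .var (.v0 6), .var (.v0 7)])))

/-! ### Polynomial-time computability of the operators of `It` -/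

namespace ItTM

/-! ### Turing machines over an arbitrary finite state space -/

/-- A transition table without oracle queries; `none` means that the machine halts. -/
abbrev Table (Q : Type) : Type := Q → Option Bool → Option (Option Bool × TDir × Q)

variable {Q : Type} {δ : Table Q}

/-- One step of a transition table. -/
def step (δ : Table Q) (c : Q × MTape) : Q × MTape :=
  match δ c.1 c.2.head with
  | none => c
  | some (b, d, q') => (q', (c.2.write b).move d)

/-- The configuration `c'` is reached from `c` in at most `n` steps. -/
def Within (δ : Table Q) (n : ℕ) (c c' : Q × MTape) : Prop :=
  ∃ m ≤ n, (step δ)^[m] c = c'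

/-- The tape whose cells from the head rightwards are `r`, and from the left of the head
leftwards are `l`. -/
def tape (l r : List (Option Bool)) : MTape := ⟨l, r.headD none, r.tail⟩

/-- The tape `tape l r` with the head moved one cell to the left. -/
def tapeL : List (Option Bool) → List (Option Bool) → MTape
  | [], r => tape [] (none :: r)
  | a :: l, r => tape l (a :: r)

theorem Within.refl (n : ℕ) (c : Q × MTape) : Within δ n c c := ⟨0, Nat.zero_le _, rfl⟩

theorem Within.mono {n n' : ℕ} {c c' : Q × MTape} (h : Within δ n c c') (hn : n ≤ n') :
    Within δ n' c c' := by
  obtain ⟨m, hm, h⟩ := h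
  exact ⟨m, hm.trans hn, h⟩

theorem Within.trans {n n' : ℕ} {c c' c'' : Q × MTape} (h : Within δ n c c')
    (h' : Within δ n' c' c'') : Within δ (n + n') c c'' := by
  obtain ⟨m, hm, h⟩ := h
  obtain ⟨m', hm', h'⟩ := h'
  refine ⟨m' + m, by omega, ?_⟩
  rw [Function.iterate_add_apply, h, h']

theorem Within.stepRight {n : ℕ} {q q' : Q} {a b : Option Bool} {l r : List (Option Bool)}
    {c : Q × MTape} (hδ : δ q a = some (b, .right, q'))
    (h : Within δ n (q', tape (b :: l) r) c) : Within δ (n + 1) (q, tape l (a :: r)) c := by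
  obtain ⟨m, hm, h⟩ := h
  refine ⟨m + 1, by omega, ?_⟩
  rw [Function.iterate_succ_apply, ← h]
  congr 1
  simp only [step, tape, List.headD_cons, hδ]
  cases r <;> rfl

theorem Within.stepLeft {n : ℕ} {q q' : Q} {a b : Option Bool} {l r : List (Option Bool)}
    {c : Q × MTape} (hδ : δ q a = some (b, .left, q'))
    (h : Within δ n (q', tapeL l (b :: r)) c) : Within δ (n + 1) (q, tape l (a :: r)) c := by
  obtain ⟨m, hm, h⟩ := h
  refine ⟨m + 1, by omega, ?_⟩
  rw [Function.iterate_succ_apply, ← h]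
  congr 1
  simp only [step, tape, List.headD_cons, hδ]
  cases l <;> rfl

/-- Started in state `q` on `c`, the table halts within `n` steps with output `out`. -/
def Yields (δ : Table Q) (n : ℕ) (c : Q × MTape) (out : Wd) : Prop :=
  ∃ c', Within δ n c c' ∧ δ c'.1 c'.2.head = none ∧ c'.2.wordAt = out

theorem Within.yields {n n' : ℕ} {c c' : Q × MTape} {out : Wd} (h : Within δ n c c')
    (h' : Yields δ n' c' out) : Yields δ (n + n') c out := by
  obtain ⟨d, hd, hd'⟩ := h'
  exact ⟨d, h.trans hd, hd'⟩

theorem Yields.mono {n n' : ℕ} {c : Q × MTape} {out : Wd} (h : Yields δ n c out)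
    (hn : n ≤ n') : Yields δ n' c out := by
  obtain ⟨d, hd, hd'⟩ := h
  exact ⟨d, hd.mono hn, hd'⟩

theorem Yields.stepRight {n : ℕ} {q q' : Q} {a b : Option Bool} {l r : List (Option Bool)}
    {out : Wd} (hδ : δ q a = some (b, .right, q'))
    (h : Yields δ n (q', tape (b :: l) r) out) : Yields δ (n + 1) (q, tape l (a :: r)) out := by
  obtain ⟨d, hd, hd'⟩ := h
  exact ⟨d, hd.stepRight hδ, hd'⟩

theorem Yields.stepLeft {n : ℕ} {q q' : Q} {a b : Option Bool} {l r : List (Option Bool)}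
    {out : Wd} (hδ : δ q a = some (b, .left, q'))
    (h : Yields δ n (q', tapeL l (b :: r)) out) : Yields δ (n + 1) (q, tape l (a :: r)) out := by
  obtain ⟨d, hd, hd'⟩ := h
  exact ⟨d, hd.stepLeft hδ, hd'⟩

/-- The Turing machine of a transition table, along an enumeration of its states. -/
def toOTM {n : ℕ} (δ : Table Q) (e : Q ≃ Fin (n + 1)) : OTM 0 :=
  ⟨n, fun q a => match δ (e.symm q) a with
    | none => .halt
    | some (b, d, q') => .step b d (e q')⟩

theorem step1_toOTM {n : ℕ} (e : Q ≃ Fin (n + 1)) (c : Q × MTape) :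
    (toOTM δ e).step1 noOracle (e c.1, c.2) = (e (step δ c).1, (step δ c).2) := by
  simp only [OTM.step1, toOTM, step, Equiv.symm_apply_apply]
  cases δ c.1 c.2.head <;> rfl

theorem iterate_step1_toOTM {n : ℕ} (e : Q ≃ Fin (n + 1)) (m : ℕ) (c : Q × MTape) :
    ((toOTM δ e).step1 noOracle)^[m] (e c.1, c.2)
      = (e ((step δ)^[m] c).1, ((step δ)^[m] c).2) := by
  induction m generalizing c with
  | zero => rfl
  | succ m ih =>
    rw [Function.iterate_succ_apply, Function.iterate_succ_apply, step1_toOTM]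
    exact ih _

theorem tape_nil_map_some (w : Wd) : tape [] (w.map some) = MTape.init w := by
  cases w <;> rfl

/-- A function computed by a transition table in quadratic time is in `FP`. -/
theorem inFP_of_yields [Fintype Q] (q₀ : Q) (δ : Table Q) {k : ℕ} (g : List Wd → Wd) (C : ℕ)
    (h : ∀ ws : List Wd, ws.length = k →
      Yields δ (C * ((ws.map List.length).sum + 1) ^ 2)
        (q₀, tape [] ((encTuple ws).map some)) (g ws)) :
    InFP k g := by
  classical
  obtain ⟨n, hn⟩ : ∃ n, Fintype.card Q = n + 1 :=
    Nat.exists_eq_succ_of_ne_zero (Fintype.card_pos_iff.2 ⟨q₀⟩).ne'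
  obtain ⟨e, he⟩ : ∃ e : Q ≃ Fin (n + 1), e q₀ = 0 :=
    ⟨(Fintype.equivFinOfCardEq hn).trans (Equiv.swap (Fintype.equivFinOfCardEq hn q₀) 0),
      by simp⟩
  have hpoly : ∀ l : List (Fin k), ∃ P : SOP 0 k, ∀ xs : Fin k → ℕ,
      P.eval noOSize xs = (l.map xs).sum + 1 := by
    intro l
    induction l with
    | nil => exact ⟨.const 1, fun xs => rfl⟩
    | cons i l ih =>
      obtain ⟨P, hP⟩ := ih
      refine ⟨.add (.var i) P, fun xs => ?_⟩
      simp only [SOP.eval, hP, List.map_cons, List.sum_cons]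
      omega
  obtain ⟨P, hP⟩ := hpoly (List.finRange k)
  refine ⟨toOTM δ e, .mul (.const C) (.mul P P), fun ws hws => ?_⟩
  obtain ⟨c, ⟨m, hm, hmc⟩, hc, hout⟩ := h ws hws
  have hrun := iterate_step1_toOTM (δ := δ) e m (q₀, MTape.init (encTuple ws))
  rw [← tape_nil_map_some, hmc, tape_nil_map_some] at hrun
  rw [he] at hrun
  refine ⟨m, hm.trans (le_of_eq ?_), ?_, ?_⟩
  · have hsum : ((List.finRange k).map fun j : Fin k => (ws.getD j []).length).sum
        = (ws.map List.length).sum := by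
      subst hws
      congr 1
      apply List.ext_getElem <;> simp
    simp only [SOP.eval, hP, hsum]
    ring
  · erw [hrun]
    simp only [OTM.isHalt, toOTM, Equiv.symm_apply_apply, hc]
  · erw [hrun]
    exact hout

/-! ### Sweeps over the tape -/

theorem within_sweepRight {q : Q} (s : List (Option Bool))
    (hδ : ∀ a ∈ s, δ q a = some (a, .right, q)) (l r : List (Option Bool)) :
    Within δ s.length (q, tape l (s ++ r)) (q, tape (s.reverse ++ l) r) := by
  induction s generalizing l with
  | nil => exact .refl _ _
  | cons a s ih =>
    refine Within.stepRight (hδ a (by simp)) ?_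
    simpa using ih (fun b hb => hδ b (by simp [hb])) (a :: l)

theorem within_sweepLeft {q : Q} (s : List (Option Bool))
    (hδ : ∀ a ∈ s, δ q a = some (a, .left, q)) (l r : List (Option Bool)) :
    Within δ s.length (q, tapeL (s ++ l) r) (q, tapeL l (s.reverse ++ r)) := by
  induction s generalizing r with
  | nil => exact .refl _ _
  | cons a s ih =>
    refine Within.stepLeft (hδ a (by simp)) ?_
    simpa using ih (fun b hb => hδ b (by simp [hb])) (a :: r)

theorem within_blanksRight {q : Q} (hδ : δ q none = some (none, .right, q)) (g : ℕ)
    (l r : List (Option Bool)) :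
    Within δ g (q, tape l (.replicate g none ++ r)) (q, tape (.replicate g none ++ l) r) := by
  have h := within_sweepRight (.replicate g none)
    (fun a ha => by rw [List.eq_of_mem_replicate ha]; exact hδ) l r
  simpa using h

theorem within_blanksLeft {q : Q} (hδ : δ q none = some (none, .left, q)) (g : ℕ)
    (l r : List (Option Bool)) :
    Within δ g (q, tapeL (.replicate g none ++ l) r) (q, tapeL l (.replicate g none ++ r)) := by
  have h := within_sweepLeft (.replicate g none)
    (fun a ha => by rw [List.eq_of_mem_replicate ha]; exact hδ) l r
  simpa using h

/-- The word `w` with each symbol preceded by a cell containing `c`. -/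
def tag (c : Option Bool) (w : Wd) : List (Option Bool) := w.flatMap fun b => [c, some b]

@[simp] theorem tag_nil (c : Option Bool) : tag c [] = [] := rfl

@[simp] theorem tag_cons (c : Option Bool) (b : Bool) (w : Wd) :
    tag c (b :: w) = c :: some b :: tag c w := rfl

@[simp] theorem tag_append (c : Option Bool) (v w : Wd) :
    tag c (v ++ w) = tag c v ++ tag c w := List.flatMap_append

@[simp] theorem length_tag (c : Option Bool) (w : Wd) : (tag c w).length = 2 * w.length := by
  induction w with
  | nil => rfl
  | cons b w ih => simp only [tag_cons, List.length_cons, ih]; omega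

theorem within_tagRight {q q' : Q} {c : Option Bool} (hq : δ q c = some (c, .right, q'))
    (hq' : ∀ b, δ q' (some b) = some (some b, .right, q)) (w : Wd)
    (l r : List (Option Bool)) :
    Within δ (2 * w.length) (q, tape l (tag c w ++ r))
      (q, tape ((tag c w).reverse ++ l) r) := by
  induction w generalizing l with
  | nil => exact .refl _ _
  | cons b w ih =>
    have h := ih (some b :: c :: l)
    simp only [tag_cons, List.reverse_cons, List.append_assoc, List.cons_append,
      List.nil_append, List.length_cons]
    exact Within.stepRight hq (Within.stepRight (hq' b) h)

theorem within_tagLeft {q q' : Q} {c c' : Option Bool}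
    (hq : ∀ b, δ q (some b) = some (some b, .left, q'))
    (hq' : δ q' c = some (c', .left, q)) (w : Wd) (l r : List (Option Bool)) :
    Within δ (2 * w.length) (q, tapeL ((tag c w).reverse ++ l) r)
      (q, tapeL l (tag c' w ++ r)) := by
  induction w generalizing l with
  | nil => exact .refl _ _
  | cons b w ih =>
    have h := ih (some b :: c :: l)
    simp only [tag_cons, List.reverse_cons, List.append_assoc, List.cons_append,
      List.nil_append, List.length_cons]
    exact h.trans (.stepLeft (n := 1) (hq b) (.stepLeft (n := 0) hq' (.refl _ _)))

theorem isSome_of_mem_tag_some {x : Bool} {w : Wd} {c : Option Bool}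
    (hc : c ∈ tag (some x) w) : c.isSome := by
  obtain ⟨b, -, hb⟩ := List.mem_flatMap.1 hc
  simp only [List.mem_cons, List.not_mem_nil, or_false] at hb
  rcases hb with rfl | rfl <;> rfl

theorem map_some_encTuple_cons (w : Wd) (ws : List Wd) :
    (encTuple (w :: ws)).map some
      = tag (some true) w ++ some false :: some false :: (encTuple ws).map some := by
  simp [encTuple, tag, List.map_flatMap]

theorem wordAt_tape_map_some (l r : List (Option Bool)) (w : Wd) :
    (tape l (w.map some ++ none :: r)).wordAt = w := by
  cases w with
  | nil => simp [tape, MTape.wordAt]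
  | cons b w =>
    simp only [tape, MTape.wordAt, List.map_cons, List.cons_append, List.headD_cons,
      List.tail_cons, Option.isSome_some, List.takeWhile_cons_of_pos, List.filterMap_cons, id]
    congr 1
    induction w with
    | nil => simp
    | cons b w ih => simpa using ih

/-! ### The machine for `!=` -/

/-- States of the machine comparing two words. -/
inductive NeState
  | start | take | seekEnd (x : Bool) | seekEndBit (x : Bool) | enterGap (x : Bool)
  | gap (x : Bool) | compare (x : Bool) | back | backWord | lastGap | lastGapEnd
  | clear | done
deriving Fintype

/-- The two words are compared symbol by symbol and erased along the way. -/
def neTable : Table NeState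
  | .start, some true => some (none, .right, .take)
  | .start, some false => some (some false, .right, .lastGap)
  | .start, none => none
  | .take, some x => some (none, .right, .seekEnd x)
  | .take, none => none
  | .seekEnd x, some true => some (some true, .right, .seekEndBit x)
  | .seekEnd x, some false => some (some false, .right, .enterGap x)
  | .seekEnd _, none => none
  | .seekEndBit x, b => some (b, .right, .seekEnd x)
  | .enterGap x, b => some (b, .right, .gap x)
  | .gap x, none => some (none, .right, .gap x)
  | .gap x, some true => some (none, .right, .compare x)
  | .gap _, some false => some (some true, .right, .clear)
  | .compare x, some y =>
      if y = x then some (none, .left, .back) else some (some true, .right, .clear)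
  | .compare _, none => none
  | .back, none => some (none, .left, .back)
  | .back, some b => some (some b, .left, .backWord)
  | .backWord, some b => some (some b, .left, .backWord)
  | .backWord, none => some (none, .right, .start)
  | .lastGap, b => some (b, .right, .lastGapEnd)
  | .lastGapEnd, none => some (none, .right, .lastGapEnd)
  | .lastGapEnd, some b => some (some b, .right, .clear)
  | .clear, _ => some (none, .left, .done)
  | .done, _ => none


theorem yields_clear (v : Bool) (l r : List (Option Bool)) :
    Yields neTable 1 (.clear, tape (some v :: l) r) [v] := by
  cases r with
  | nil => exact ⟨_, Within.stepLeft (n := 0) (a := none) (r := []) rfl (.refl _ _), rfl, rfl⟩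
  | cons a r => exact ⟨_, Within.stepLeft (n := 0) rfl (.refl _ _), rfl, rfl⟩

theorem yields_ne (a b : Wd) (k m : ℕ) :
    Yields neTable (a.length * (8 * a.length + 2 * m + 10) + m + 4)
      (.start, tape (.replicate k none)
        (tag (some true) a ++ some false :: some false :: (.replicate m none ++
          (tag (some true) b ++ [some false, some false]))))
      [decide (a ≠ b)] := by
  induction a generalizing b k m with
  | nil =>
    refine .mono (.stepRight rfl (.stepRight rfl
      (Within.yields (within_blanksRight rfl m _ _) (n' := 2) ?_))) (by simp)
    cases b with
    | nil => exact .stepRight rfl (yields_clear _ _ _)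
    | cons y b => exact .stepRight rfl (yields_clear _ _ _)
  | cons x a ih =>
    simp only [tag_cons, List.cons_append]
    refine .mono (.stepRight rfl (.stepRight rfl
      (Within.yields (within_tagRight rfl (fun _ => rfl) a _ _)
        (.stepRight rfl (.stepRight rfl (Within.yields (within_blanksRight rfl m _ _)
          (n' := a.length * (8 * a.length + 2 * (m + 2) + 10) + (m + 2) + 4
            + (2 * a.length + m + 6)) ?_)))))) (by simp only [List.length_cons]; nlinarith)
    cases b with
    | nil =>
      simp only [tag_nil, List.nil_append]
      exact .mono (.stepRight rfl (yields_clear _ _ _)) (by omega)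
    | cons y b =>
      simp only [tag_cons, List.cons_append]
      refine .mono (.stepRight rfl (n := a.length * (8 * a.length + 2 * (m + 2) + 10) +
        (m + 2) + 4 + (2 * a.length + m + 5)) ?_) (by omega)
      by_cases hxy : y = x
      · subst hxy
        have hleft := within_sweepLeft (δ := neTable) (q := .backWord)
          (some false :: (tag (some true) a).reverse)
          (fun c hc => by
            have hc' : c.isSome := by
              rcases List.mem_cons.1 hc with rfl | hc
              · rfl
              · exact isSome_of_mem_tag_some (List.mem_reverse.1 hc)
            obtain ⟨b, rfl⟩ := Option.isSome_iff_exists.1 hc'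
            rfl)
          (.replicate (k + 2) none)
          (some false :: (.replicate (m + 1) none ++
            none :: (tag (some true) b ++ [some false, some false])))
        refine .mono (.stepLeft (show neTable (.compare y) (some y) = some (none, .left, .back) from if_pos rfl)
          (Within.yields (within_blanksLeft rfl (m + 1)
            (some false :: some false :: ((tag (some true) a).reverse ++
              .replicate (k + 2) none)) _)
            (.stepLeft rfl (Within.yields hleft (.stepRight rfl
              (n := a.length * (8 * a.length + 2 * (m + 2) + 10) + (m + 2) + 4) ?_))))) ?_
        · have hdec : [decide (y :: a ≠ y :: b)] = [decide (a ≠ b)] := by simp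
          have hm : (.replicate (m + 2) none ++ (tag (some true) b ++ [some false, some false]) :
              List (Option Bool)) = .replicate (m + 1) none ++
                none :: (tag (some true) b ++ [some false, some false]) := by
            rw [List.replicate_succ', List.append_assoc]
            rfl
          have h := ih b (k + 2) (m + 2)
          rw [hm, List.replicate_succ (n := k + 1)] at h
          rw [hdec]
          simpa using h
        · simp
          omega
      · have hne : [decide (x :: a ≠ y :: b)] = [true] := by simp [Ne.symm hxy]
        rw [hne]
        exact .mono (.stepRight (if_neg hxy) (yields_clear _ _ _)) (by omega)

theorem inFP_ne : InFP (opArity 6) (opSem 6) := by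
  refine inFP_of_yields .start neTable _ 20 fun ws hws => ?_
  obtain ⟨a, b, rfl⟩ := List.length_eq_two.1 hws
  have h := yields_ne a b 0 0
  simp only [map_some_encTuple_cons]
  refine Yields.mono h ?_
  simp only [List.map_cons, List.map_nil, List.sum_cons, List.sum_nil]
  nlinarith [Nat.zero_le (a.length * b.length), Nat.zero_le (b.length * b.length)]

/-! ### The machine for `pred` and `lmin` -/

/-- States of the machine computing `pred` (from `predStart`) and `lmin` (from `aMarked`). -/
inductive MinState
  | predStart | predBit
  | aMarked | aMarkedBit | aPlain | aPlainBit | bMarked | bMarkedBit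
  | back | backFlag | bMarkedLast | bMarkedLastBit
  | keepA | keepAFlag | keepB | keepBFlag | keepBEnd
  | read | readBit | carry (x : Bool) | store (x : Bool) | rewind | rewindWord | enter | done
deriving Fintype

/-- `lmin` marks the symbols of both words in parallel by erasing the cells preceding them;
the word to be returned, whose symbols are then all marked, is unmarked and compacted. -/
def minTable : Table MinState
  | .predStart, some true => some (none, .right, .predBit)
  | .predStart, _ => some (none, .left, .done)
  | .predBit, b => some (b, .right, .read)
  | .aMarked, none => some (none, .right, .aMarkedBit)
  | .aMarked, some true => some (none, .right, .aPlainBit)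
  | .aMarked, some false => some (some false, .right, .bMarkedLastBit)
  | .aMarkedBit, b => some (b, .right, .aMarked)
  | .aPlain, some true => some (some true, .right, .aPlainBit)
  | .aPlain, some false => some (some false, .right, .bMarkedBit)
  | .aPlain, none => none
  | .aPlainBit, b => some (b, .right, .aPlain)
  | .bMarked, none => some (none, .right, .bMarkedBit)
  | .bMarked, some true => some (none, .left, .back)
  | .bMarked, some false => some (some false, .left, .keepB)
  | .bMarkedBit, b => some (b, .right, .bMarked)
  | .back, some b => some (some b, .left, .backFlag)
  | .back, none => some (none, .right, .aMarked)
  | .backFlag, c => some (c, .left, .back)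
  | .bMarkedLast, none => some (none, .right, .bMarkedLastBit)
  | .bMarkedLast, some true => some (some true, .left, .keepA)
  | .bMarkedLast, some false => some (some false, .left, .keepB)
  | .bMarkedLastBit, b => some (b, .right, .bMarkedLast)
  | .keepA, some b => some (some b, .left, .keepAFlag)
  | .keepA, none => some (some true, .right, .read)
  | .keepAFlag, none => some (some true, .left, .keepA)
  | .keepAFlag, some c => some (some c, .left, .keepA)
  | .keepB, b => some (b, .left, .keepBFlag)
  | .keepBFlag, none => some (some true, .left, .keepB)
  | .keepBFlag, some _ => some (none, .right, .keepBEnd)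
  | .keepBEnd, b => some (b, .right, .read)
  | .read, none => some (none, .right, .read)
  | .read, some true => some (none, .right, .readBit)
  | .read, some false => some (none, .left, .rewind)
  | .readBit, some x => some (none, .left, .carry x)
  | .readBit, none => none
  | .carry x, none => some (none, .left, .carry x)
  | .carry x, some b => some (some b, .right, .store x)
  | .store x, _ => some (some x, .right, .read)
  | .rewind, none => some (none, .left, .rewind)
  | .rewind, some b => some (some b, .left, .rewindWord)
  | .rewindWord, some b => some (some b, .left, .rewindWord)
  | .rewindWord, none => some (none, .right, .enter)
  | .enter, b => some (b, .right, .done)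
  | .done, _ => none

theorem replicate_append_cons {α : Type} (g : ℕ) (a : α) (r : List α) :
    List.replicate g a ++ a :: r = .replicate (g + 1) a ++ r := by
  rw [List.replicate_succ', List.append_assoc]
  rfl

theorem tapeL_replicate_none (k : ℕ) (r : List (Option Bool)) :
    tapeL (.replicate k none) r = tape (.replicate (k - 1) none) (none :: r) := by
  cases k <;> rfl

/-- Compaction: `w` is appended to the word `v` stored to the right of a nonblank cell. -/
theorem yields_read (w v : Wd) (g : ℕ) (s : Bool) (l r : List (Option Bool))
    (hl : ∃ l', ∀ r, tapeL l r = tape l' (none :: r)) :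
    Yields minTable (w.length * (2 * g + 2 * w.length + 10) + 2 * g + v.length + 5)
      (.read, tape (.replicate g none ++ (v.reverse.map some ++ some s :: l))
        (tag (some true) w ++ some false :: r))
      (v ++ w) := by
  induction w generalizing v g with
  | nil =>
    obtain ⟨c, t, ht⟩ : ∃ c t, (v.reverse ++ [s]).map some = some c :: t ∧
        ∀ a ∈ t, ∃ b, a = some b := by
      cases h : v.reverse ++ [s] with
      | nil => simp at h
      | cons c t => exact ⟨c, t.map some, rfl, fun a ha => by
          obtain ⟨b, -, rfl⟩ := List.mem_map.1 ha
          exact ⟨b, rfl⟩⟩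
    obtain ⟨ht, hsome⟩ := ht
    have hrev : t.reverse ++ [some c] = some s :: v.map some := by
      rw [← List.reverse_cons, ← ht]
      simp
    have hlen : t.length = v.length := by simpa using (congrArg List.length ht).symm
    have hleft := within_sweepLeft (δ := minTable) (q := .rewindWord) t
      (fun a ha => by obtain ⟨b, rfl⟩ := hsome a ha; rfl) l
      (some c :: (.replicate g none ++ none :: r))
    have hcells : t.reverse ++ some c :: (.replicate g none ++ none :: r)
        = some s :: (v.map some ++ none :: (.replicate g none ++ r)) := by
      rw [replicate_append_cons, List.append_cons, hrev]
      rfl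
    have hinput : (v.reverse.map some ++ some s :: l : List (Option Bool))
        = some c :: (t ++ l) := by
      rw [← List.cons_append, ← ht]
      simp
    obtain ⟨l', hl⟩ := hl
    rw [hcells, hl] at hleft
    rw [hinput, List.append_nil]
    refine .mono (.stepLeft rfl (Within.yields (within_blanksLeft rfl g (some c :: _) _)
      (.stepLeft rfl (Within.yields hleft (.stepRight rfl (.stepRight rfl
        ⟨_, .refl 0 _, rfl, wordAt_tape_map_some _ _ _⟩)))))) ?_
    simp only [hlen, List.length_nil]
    omega
  | cons x w ih =>
    simp only [tag_cons, List.cons_append]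
    obtain ⟨c, t, ht⟩ : ∃ c t,
        v.reverse.map some ++ some s :: l = some c :: t := by
      cases h : v.reverse with
      | nil => exact ⟨s, _, rfl⟩
      | cons c t => exact ⟨c, _, rfl⟩
    have h := ih (v ++ [x]) (g + 1)
    simp only [List.reverse_append, List.reverse_cons, List.reverse_nil, List.nil_append,
      List.cons_append, List.map_cons, List.append_assoc] at h
    rw [ht] at h ⊢
    have hblanks := within_blanksRight (δ := minTable) (q := .read) rfl (g + 1)
      (some x :: some c :: t) (tag (some true) w ++ some false :: r)
    rw [← replicate_append_cons] at hblanks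
    refine .mono (.stepRight rfl (.stepLeft rfl (Within.yields
      (within_blanksLeft (δ := minTable) (q := MinState.carry x) rfl (g + 1) (some c :: t) _)
      (.stepRight (b := some c) (q' := .store x) rfl (.stepRight rfl
        (Within.yields hblanks h)))))) ?_
    simp only [List.length_append, List.length_cons, List.length_nil]
    nlinarith

theorem yields_keepB (b : Wd) (l r : List (Option Bool)) :
    Yields minTable (b.length * (2 * b.length + 12) + 8)
      (.keepB, tapeL ((tag none b).reverse ++ some false :: some false :: l) (some false :: r))
      b := by
  have h := yields_read b [] 0 false (none :: l) r ⟨l, fun _ => rfl⟩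
  refine .mono (Within.yields (within_tagLeft (c' := some true) (fun _ => rfl) rfl b _ _)
    (.stepLeft rfl (.stepRight rfl (.stepRight rfl h)))) ?_
  simp only [List.length_nil]
  nlinarith

theorem yields_keepA (a b : Wd) (k : ℕ) (r : List (Option Bool)) :
    Yields minTable (a.length * (2 * a.length + 12) + 2 * b.length + 8)
      (.keepA, tapeL ((tag none b).reverse ++ some false :: some false ::
        ((tag none a).reverse ++ .replicate k none)) r)
      a := by
  have h := yields_read a [] 0 true (.replicate (k - 1) none)
    (some false :: (tag (some true) b ++ r)) ⟨_, tapeL_replicate_none (k - 1)⟩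
  have hlast : Within minTable _ _ _ := within_tagLeft (δ := minTable) (q := .keepA)
    (q' := .keepAFlag) (c := none) (c' := some true) (fun _ => rfl) rfl a (.replicate k none)
    (some false :: some false :: (tag (some true) b ++ r))
  rw [tapeL_replicate_none] at hlast
  refine .mono (Within.yields (within_tagLeft (fun _ => rfl) rfl b _ _)
    (.stepLeft rfl (.stepLeft rfl (Within.yields hlast (.stepRight rfl h))))) ?_
  simp only [List.length_nil]
  nlinarith

theorem yields_min (N : ℕ) (a b a' b' : Wd) (k : ℕ) (hab : a.length = b.length)
    (hN : a.length + a'.length = N) :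
    Yields minTable (a'.length * (8 * N + 20) + 2 * N * N + 24 * N + 24)
      (.aMarked, tape (.replicate k none)
        (tag none a ++ (tag (some true) a' ++ some false :: some false ::
          (tag none b ++ (tag (some true) b' ++ [some false, some false])))))
      (lminW (a ++ a') (b ++ b')) := by
  induction a' generalizing a b b' k with
  | nil =>
    refine .mono (Within.yields (within_tagRight rfl (fun _ => rfl) a _ _)
      (.stepRight rfl (.stepRight rfl (Within.yields
        (within_tagRight rfl (fun _ => rfl) b _ _)
        (n' := a.length * (2 * a.length + 12) + 2 * b.length + 9) ?_)))) ?_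
    · cases b' with
      | nil =>
        have hmin : lminW (a ++ []) (b ++ []) = b := by simp [lminW, hab]
        rw [hmin]
        refine .mono (.stepLeft rfl (yields_keepB _ _ _)) ?_
        rw [hab]
        omega
      | cons y b' =>
        have hmin : lminW (a ++ []) (b ++ y :: b') = a := by simp [lminW, hab]
        rw [hmin]
        exact .stepLeft rfl (yields_keepA _ _ _ _)
    · simp only [List.length_nil, add_zero] at hN ⊢
      subst hN
      rw [← hab]
      nlinarith
  | cons x a' ih =>
    simp only [tag_cons, List.cons_append]
    refine .mono (Within.yields (within_tagRight rfl (fun _ => rfl) a _ _)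
      (.stepRight rfl (.stepRight rfl (Within.yields
        (within_tagRight rfl (fun _ => rfl) a' _ _) (.stepRight rfl (.stepRight rfl
          (Within.yields (within_tagRight rfl (fun _ => rfl) b _ _)
            (n' := a'.length * (8 * N + 20) + 2 * N * N + 24 * N + 24 +
              (4 * N + 8)) ?_))))))) ?_
    · cases b' with
      | nil =>
        have hmin : lminW (a ++ x :: a') (b ++ []) = b := by simp [lminW, hab]
        rw [hmin]
        refine .mono (.stepLeft rfl (yields_keepB _ _ _)) ?_
        simp only [List.length_cons] at hN
        nlinarith
      | cons y b' =>
        have h := ih (a ++ [x]) (b ++ [y]) b' (k - 1 + 1) (by simp [hab])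
          (by simp only [List.length_append, List.length_cons, List.length_nil] at hN ⊢; omega)
        have hlast : Within minTable _ _ _ := within_tagLeft (δ := minTable) (q := .back)
          (q' := .backFlag) (c := none) (c' := none) (fun _ => rfl) rfl (a ++ [x])
          (.replicate k none)
          (tag (some true) a' ++ some false :: some false :: (tag none b ++ none :: some y ::
            (tag (some true) b' ++ [some false, some false])))
        rw [tapeL_replicate_none] at hlast
        have hcells : (tag none (a ++ [x])).reverse ++ .replicate k none
            = some x :: none :: ((tag none a).reverse ++ .replicate k none) := by simp
        rw [hcells] at hlast
        simp only [List.append_assoc, tag_append, tag_cons, tag_nil, List.cons_append,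
          List.nil_append] at h hlast
        refine .mono (.stepLeft rfl (Within.yields (within_tagLeft (fun _ => rfl) rfl b _ _)
          (.stepLeft rfl (.stepLeft rfl (Within.yields
            (within_tagLeft (fun _ => rfl) rfl a' _ _)
            (Within.yields hlast (.stepRight rfl h))))))) ?_
        simp only [List.length_append, List.length_cons, List.length_nil] at hN ⊢
        omega
    · simp only [List.length_cons] at hN ⊢
      rw [← hab]
      nlinarith

theorem inFP_min : InFP (opArity 7) (opSem 7) := by
  refine inFP_of_yields .aMarked minTable _ 30 fun ws hws => ?_
  obtain ⟨a, b, rfl⟩ := List.length_eq_two.1 hws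
  have h := yields_min _ [] [] a b 0 rfl rfl
  simp only [map_some_encTuple_cons]
  refine Yields.mono h ?_
  simp only [List.map_cons, List.map_nil, List.sum_cons, List.sum_nil, List.length_nil]
  nlinarith [Nat.zero_le (a.length * b.length), Nat.zero_le (b.length * b.length)]

theorem inFP_pred : InFP (opArity 1) (opSem 1) := by
  refine inFP_of_yields .predStart minTable _ 30 fun ws hws => ?_
  obtain ⟨a, rfl⟩ := List.length_eq_one_iff.1 hws
  simp only [map_some_encTuple_cons, List.map_cons, List.map_nil, List.sum_cons, List.sum_nil]
  cases a with
  | nil => exact .mono (.stepLeft rfl ⟨_, .refl 0 _, rfl, rfl⟩) (by simp)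
  | cons x a =>
    have h := yields_read a [] 0 x [none] [some false] ⟨[], fun _ => rfl⟩
    refine .mono (.stepRight rfl (.stepRight rfl h)) ?_
    simp only [List.length_cons, List.length_nil]
    nlinarith

theorem inFP_eps : InFP (opArity 0) (opSem 0) := by
  refine inFP_of_yields () (fun _ _ => none) _ 0 fun ws hws => ?_
  obtain rfl := List.length_eq_zero_iff.1 hws
  exact ⟨_, .refl _ _, rfl, rfl⟩

end ItTM
/-! ### Typing -/

/-- The operator tiers used in `It`. -/
def itOTE : OTE := fun o k =>
  { s | k = 1 ∧ (o = 0 ∧ s = ([], 1) ∨ o = 1 ∧ s = ([1], 1) ∨ o = 6 ∧ s = ([1, 1], 1) ∨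
      o = 7 ∧ s = ([0, 1], 0)) }

theorem neutralOp_pred : NeutralOp 1 := by
  refine Or.inr (Or.inr fun ws hws => ?_)
  obtain ⟨a, rfl⟩ := List.length_eq_one_iff.1 hws
  exact ⟨a, by simp, a.take 1, [], by cases a <;> simp [opSem]⟩

theorem neutralOp_ne : NeutralOp 6 := by
  refine Or.inr (Or.inl fun ws => ?_)
  by_cases h : ws.getD 0 [] = ws.getD 1 []
  · exact Or.inl (by simp only [opSem, h, ne_eq, not_true, decide_false])
  · exact Or.inr (by simp only [opSem, h, ne_eq, not_false_iff, decide_true])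

theorem neutralOp_lmin : NeutralOp 7 := by
  refine Or.inr (Or.inr fun ws hws => ?_)
  obtain ⟨a, b, rfl⟩ := List.length_eq_two.1 hws
  refine ⟨lminW a b, ?_, [], [], by simp [opSem]⟩
  unfold lminW
  split <;> simp

theorem safeOTE_itOTE : SafeOTE itOTE := by
  rintro o k ks k' ⟨rfl, ⟨rfl, h⟩ | ⟨rfl, h⟩ | ⟨rfl, h⟩ | ⟨rfl, h⟩⟩ <;>
    obtain ⟨rfl, rfl⟩ := Prod.mk.inj h
  · exact ⟨.inl (.inl rfl), ItTM.inFP_eps, rfl, by simp, fun h => absurd (.inl rfl) h⟩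
  · exact ⟨.inl neutralOp_pred, ItTM.inFP_pred, rfl, by simp, fun h => absurd neutralOp_pred h⟩
  · exact ⟨.inl neutralOp_ne, ItTM.inFP_ne, rfl, by simp, fun h => absurd neutralOp_ne h⟩
  · exact ⟨.inl neutralOp_lmin, ItTM.inFP_min, rfl, by simp, fun h => absurd neutralOp_lmin h⟩

/-- The tiers of the variables of `It`. -/
def itVEnv : VEnv := fun x => if x = 1 ∨ x = 3 then some 1 else some 0

theorem TyExpr.op_one {Γ : VEnv} {Δ : OTE} {o : ℕ} {e : Expr} {k₁ k kin kout : ℕ}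
    (hΔ : ([k₁], k) ∈ Δ o kin) (he : TyExpr Γ Δ e (k₁, kin, kout)) :
    TyExpr Γ Δ (.op o [e]) (k, kin, kout) := by
  refine .eop hΔ rfl fun i κ e' hκ he' => ?_
  match i with
  | 0 =>
    obtain rfl : k₁ = κ := by simpa using hκ
    obtain rfl : e = e' := by simpa using he'
    exact he
  | i + 1 => simp at hκ

theorem TyExpr.op_two {Γ : VEnv} {Δ : OTE} {o : ℕ} {e₁ e₂ : Expr} {k₁ k₂ k kin kout : ℕ}
    (hΔ : ([k₁, k₂], k) ∈ Δ o kin) (h₁ : TyExpr Γ Δ e₁ (k₁, kin, kout))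
    (h₂ : TyExpr Γ Δ e₂ (k₂, kin, kout)) : TyExpr Γ Δ (.op o [e₁, e₂]) (k, kin, kout) := by
  refine .eop hΔ rfl fun i κ e' hκ he' => ?_
  match i with
  | 0 =>
    obtain rfl : k₁ = κ := by simpa using hκ
    obtain rfl : e₁ = e' := by simpa using he'
    exact h₁
  | 1 =>
    obtain rfl : k₂ = κ := by simpa using hκ
    obtain rfl : e₂ = e' := by simpa using he'
    exact h₂
  | i + 2 => simp at hκ

theorem tyStmt_itProc : TyStmt itVEnv itOTE itProc.body (1, 1, 0) := by
  have hvar : ∀ x k kout, itVEnv x = some k →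
      TyExpr itVEnv itOTE (.var x) (k, 1, kout) := fun x k kout h => .evar h
  have hε : ∀ kout, TyExpr itVEnv itOTE (.op 0 []) (1, 1, kout) := fun kout =>
    .eop (ks := []) ⟨rfl, .inl ⟨rfl, rfl⟩⟩ rfl (by simp)
  refine .sseq (.ssub (.sasg rfl (hvar 2 0 _ rfl) le_rfl)) (.swinit ?_ (.sseq ?_ ?_) le_rfl)
  · exact .op_two ⟨rfl, by simp⟩ (hvar 3 1 _ rfl) (hε _)
  · exact .ssub (.sasg rfl (.eor (.op_two ⟨rfl, by simp⟩ (hvar 4 0 _ rfl) (hvar 1 1 _ rfl))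
      (hvar 1 1 _ rfl) Nat.zero_lt_one (Nat.zero_le _)) le_rfl)
  · exact .sasg rfl (.op_one ⟨rfl, by simp⟩ (hvar 3 1 _ rfl)) le_rfl

theorem itProg_mem_SAFEr : itProg ∈ SAFEr 0 := by
  refine ⟨itOTE, safeOTE_itOTE, fun _ => none, fun _ => (itVEnv, (1, 1, 0)), ty2 1 3, ?_,
    1, 3, rfl⟩
  refine .pbox (.pbox (.pbox (.pbox (.pdec ?_ (.pterm
    (.pcall (p := itProc) (by simp) rfl rfl rfl ?_ ?_))))))
  · intro p hp
    obtain rfl := List.mem_singleton.1 hp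
    exact tyStmt_itProc
  · intro c hc
    obtain rfl := List.mem_singleton.1 hc
    exact .papp (T := .W) (.pvar rfl) (.pvar rfl)
  · intro t ht
    simp only [List.mem_cons, List.not_mem_nil, or_false] at ht
    rcases ht with rfl | rfl | rfl <;> exact .pvar rfl

/-! ### Size-change termination -/

theorem guardVars_itProc : guardVars itProc.body = {3} := by
  simp [itProc, guardVars, isNeqEps]

theorem isSome_res_singleton {x y z : ℕ} {G : SCG} (h : (G.res {x} y z).isSome) : y = x := by
  unfold SCG.res at h
  split at h
  · next h' => exact h'.1
  · simp at h

theorem itProg_mem_SCPs : itProg ∈ SCPs := by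
  intro p hp
  obtain rfl : p = itProc := by simpa [itProg, mkBoxes, procsOf] using hp
  rw [ProcSCP, guardVars_itProc]
  refine ⟨trivial, ⟨3, rfl, ?_, ?_⟩, trivial, trivial⟩
  · rintro gs ⟨_, rfl, _, rfl, rfl⟩
    refine ⟨?_, fun _ => 3, rfl, rfl, ?_, 1, by simp [resList], ?_⟩
    · intro G hG z y₁ y₂ h₁ h₂
      obtain ⟨G, -, rfl⟩ := List.mem_map.1 hG
      rw [isSome_res_singleton h₁, isSome_res_singleton h₂]
    · intro i hi
      have hi' : i < 2 := by simpa [resList] using hi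
      interval_cases i <;> simp [resList, SCG.res, mkSCG, exprSrc, opDec]
    · simp [resList, SCG.res, mkSCG, exprSrc, opDec]
  · intro f hf
    simp [Ls] at hf

/-! ### Evaluation -/

@[simp] theorem updW0_w (μ : Store) (x y : ℕ) (v : Wd) :
    (μ.updW0 x v).w y = if y = x then some v else μ.w y := rfl

@[simp] theorem updW0_o (μ : Store) (x : ℕ) (v : Wd) : (μ.updW0 x v).o = μ.o := rfl

theorem EvalExpr.op_zero {σ : List Proc} {μ : Store} {φ : Cnt} {o : ℕ} (ho : opArity o = 0) :
    EvalExpr σ μ φ (.op o []) (opSem o []) :=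
  .op [] ho.symm rfl (by simp)

theorem EvalExpr.op_one {σ : List Proc} {μ : Store} {φ : Cnt} {o : ℕ} {e : Expr} {w : Wd}
    (ho : opArity o = 1) (h : EvalExpr σ μ φ e w) :
    EvalExpr σ μ φ (.op o [e]) (opSem o [w]) := by
  refine .op [w] ho.symm rfl fun i e' w' he hw => ?_
  match i with
  | 0 =>
    obtain rfl : e = e' := by simpa using he
    obtain rfl : w = w' := by simpa using hw
    exact h
  | i + 1 => simp at he

theorem EvalExpr.op_two {σ : List Proc} {μ : Store} {φ : Cnt} {o : ℕ} {e₁ e₂ : Expr}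
    {w₁ w₂ : Wd} (ho : opArity o = 2) (h₁ : EvalExpr σ μ φ e₁ w₁)
    (h₂ : EvalExpr σ μ φ e₂ w₂) :
    EvalExpr σ μ φ (.op o [e₁, e₂]) (opSem o [w₁, w₂]) := by
  refine .op [w₁, w₂] ho.symm rfl fun i e' w' he hw => ?_
  match i with
  | 0 =>
    obtain rfl : e₁ = e' := by simpa using he
    obtain rfl : w₁ = w' := by simpa using hw
    exact h₁
  | 1 =>
    obtain rfl : e₂ = e' := by simpa using he
    obtain rfl : w₂ = w' := by simpa using hw
    exact h₂
  | i + 2 => simp at he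

/-- The loop of `It` iterates the oracle, on truncated arguments. -/
theorem evalStmt_itLoop {σ : List Proc} {φ : Cnt} {f : Wd → Wd} {a : Wd}
    (hφ : φ 0 = some (8, .app (.var (.v1 1)) (.var (.v0 8)))) (c u : Wd) (μ : Store)
    (ho : μ.o 1 = some f) (h1 : μ.w 1 = some a) (h3 : μ.w 3 = some c) (h4 : μ.w 4 = some u) :
    ∃ μ', EvalStmt σ μ φ
        (.while (.op 6 [.var 3, .op 0 []])
          (.seq (.assign 4 (.oracleCall 0 (.op 7 [.var 4, .var 1]) (.var 1)))
            (.assign 3 (.op 1 [.var 3])))) μ' ∧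
      μ'.w 4 = some ((fun x => f (truncW (lminW x a) a))^[c.length] u) := by
  induction c generalizing u μ with
  | nil => exact ⟨μ, .whF (.op_two (w₁ := []) rfl (.var h3) (.op_zero rfl)), h4⟩
  | cons b c ih =>
    obtain ⟨μ', hμ', hw⟩ := ih (f (truncW (lminW u a) a))
      ((μ.updW0 4 (f (truncW (lminW u a) a))).updW0 3 c) (by simpa using ho) (by simpa using h1)
      (by simp) (by simp)
    refine ⟨μ', .whT (.op_two (w₁ := b :: c) rfl (.var h3) (.op_zero rfl))
      (.seq (.seq (.asg ?_) (.asg ?_)) hμ'), hw⟩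
    · exact .orc (.op_two rfl (.var h4) (.var h1)) (.var h1) hφ
        (.oa (.val (.oapp _ _)) (.tvar (.val (.var0 _)) (by simp; rfl)) (by simpa using ho))
    · exact .op_one (o := 1) (w := b :: c) rfl (.var (by simpa using h3))

theorem computesTotal_itProg :
    computesTotal itProg 1 3
      (fun fs ws =>
        (fun x => fs 0 (truncW (lminW x (ws 0)) (ws 0)))^[(ws 2).length] (ws 1)) := by
  refine ⟨[1], [5, 6, 7], [itProc], _, rfl, rfl, by simp, by simp, rfl, fun fs ws => ?_⟩
  let μ := (((((initStore [1] [5, 6, 7] (List.ofFn fs) (List.ofFn ws)).updW0 1 (ws 0)).updW0 2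
    (ws 1)).updW0 3 (ws 2)).updW0 4 [])
  obtain ⟨μ', hμ', hw⟩ := evalStmt_itLoop (σ := [itProc]) (f := fs 0) (a := ws 0)
    (φ := contOf [0] [(8, .app (.var (.v1 1)) (.var (.v0 8)))]) rfl (ws 2) (ws 1)
    (μ.updW0 4 (ws 1)) rfl rfl rfl rfl
  refine .box rfl (.box rfl (.box rfl (.box rfl (.dec (.term
    (.call (p := itProc) (ws := [ws 0, ws 1, ws 2]) (.val (.call _ _ _)) (by simp) rfl rfl rfl rfl
      ?_ (.seq (.asg (w := ws 1) (.var rfl)) hμ') hw))))))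
  intro i t w ht hw
  match i with
  | 0 | 1 | 2 =>
    simp only [List.getElem?_cons_zero, List.getElem?_cons_succ, Option.some.injEq] at ht hw
    subst ht hw
    exact .tvar (.val (.var0 _)) rfl
  | i + 3 => simp at ht

/-- The program `It` belongs to `SAFE₀ ∩ SCP_S`, is terminating, and
computes the padded variant of the bounded iterator `I'` :
`⟦It⟧(f)(a,b,c) = G^{|c|}(b)` where `G(x) = f(⟦↾⟧(lmin(x,a), a))`. -/
theorem itProg_props :
    itProg ∈ SAFEr 0 ∧ itProg ∈ SCPs ∧ itProg ∈ SN ∧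
    computesTotal itProg 1 3
      (fun fs ws =>
        (fun x => fs 0 (truncW (lminW x (ws 0)) (ws 0)))^[(ws 2).length] (ws 1)) := by
  exact ⟨itProg_mem_SAFEr, itProg_mem_SCPs, ⟨_, _, _, computesTotal_itProg⟩, computesTotal_itProg⟩
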